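/- Let L be a (left) Leibniz algebra over a field F, let A ⊆ L be an ideal with L·A ⊆ A and A·L = 0, let X = L × L with multiplication (x, w)·(x', w') = (x·x', x·w'), and let D = {(a, -a) : a ∈ A}, which is an ideal of X. Form the quotient Leibniz algebra M = X/D, and let B be the image of W = {0} × L in M and Ū the image of E = {(x, -x) : x ∈ L} in M. Then: B is an ideal of M with B·M = 0; Ū is a subalgebra of M; and M = Ū ⊕ B as vector spaces (Ū ∩ B = 0 and Ū + B = M), i.e. M splits over B. -/

import Mathlib

/-- Construction 3: with `A·L = 0`, `X = L × L`, `D = {(a, -a) : a ∈ A}` and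
`M = X/D`, the image `B` of `{0} × L` is an ideal of `M` with `B·M = 0`, the
image `Ū` of `E = {(x, -x)}` is a subalgebra, and `M = Ū ⊕ B`. -/
theorem splitting_algebra_construction (F : Type*) [Field F] (L : Type*)
    [AddCommGroup L] [Module F L]
    (mul : L →ₗ[F] L →ₗ[F] L)
    (leib : ∀ x y z : L, mul x (mul y z) = mul (mul x y) z + mul y (mul x z))
    (A : Submodule F L)
    (hLA : ∀ x : L, ∀ a ∈ A, mul x a ∈ A)
    (hAL : ∀ a ∈ A, ∀ x : L, mul a x = 0) :
    let D : Submodule F (L × L) :=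
      A.map ((LinearMap.id : L →ₗ[F] L).prod (-LinearMap.id))
    let M := (L × L) ⧸ D
    let B : Submodule F M := (LinearMap.range (LinearMap.inr F L L)).map D.mkQ
    let Ubar : Submodule F M :=
      (LinearMap.range ((LinearMap.id : L →ₗ[F] L).prod (-LinearMap.id))).map D.mkQ
    ∀ mulM : M →ₗ[F] M →ₗ[F] M,
      (∀ p q : L × L, mulM (D.mkQ p) (D.mkQ q) = D.mkQ (mul p.1 q.1, mul p.1 q.2)) →
      (∀ m : M, ∀ b ∈ B, mulM m b ∈ B) ∧
      (∀ b ∈ B, ∀ m : M, mulM b m = 0) ∧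
      (∀ u ∈ Ubar, ∀ u' ∈ Ubar, mulM u u' ∈ Ubar) ∧
      Ubar ⊓ B = ⊥ ∧ Ubar ⊔ B = ⊤ := by
  intro D M B Ubar mulM hmul
  have surj : ∀ m : M, ∃ p : L × L, D.mkQ p = m := D.mkQ_surjective
  have hB : ∀ w : L, D.mkQ (0, w) ∈ B := fun w => ⟨(0, w), ⟨w, rfl⟩, rfl⟩
  have hU : ∀ x : L, D.mkQ (x, -x) ∈ Ubar := fun x => ⟨(x, -x), ⟨x, rfl⟩, rfl⟩
  refine ⟨?_, ?_, ?_, ?_, ?_⟩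
  · rintro m _ ⟨_, ⟨w, rfl⟩, rfl⟩
    obtain ⟨p, rfl⟩ := surj m
    rw [hmul]
    simpa using hB (mul p.1 w)
  · rintro _ ⟨_, ⟨w, rfl⟩, rfl⟩ m
    obtain ⟨p, rfl⟩ := surj m
    rw [hmul]
    have h : ((mul 0 p.1, mul 0 p.2) : L × L) = 0 := by simp
    exact (congrArg D.mkQ h).trans (map_zero D.mkQ)
  · rintro _ ⟨_, ⟨x, rfl⟩, rfl⟩ _ ⟨_, ⟨y, rfl⟩, rfl⟩
    rw [hmul]
    simpa using hU (mul x y)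
  · rw [eq_bot_iff]
    rintro _ ⟨⟨_, ⟨x, rfl⟩, rfl⟩, ⟨_, ⟨w, rfl⟩, h⟩⟩
    obtain ⟨a, ha, hax⟩ := (Submodule.Quotient.eq D).1 h.symm
    have hx : a = x := by simpa using congrArg Prod.fst hax
    subst hx
    exact (Submodule.Quotient.mk_eq_zero D).2 ⟨a, ha, rfl⟩
  · rw [eq_top_iff]
    intro m _
    obtain ⟨⟨x, y⟩, rfl⟩ := surj m
    have h : ((x, y) : L × L) = (x, -x) + (0, x + y) := by simp
    rw [h, map_add]
    exact Submodule.add_mem_sup (hU x) (hB (x + y))
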